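/- For every x ∈ ℝ and every δ ≥ 0, one has xδ + δ²/2 ≤ Ψ(x+δ) − Ψ(x) ≤ ρ(x)δ + δ²/2, where Ψ(x) = −log Φ̄(x). Equivalently, exp(−xδ − δ²/2) ≥ Φ̄(x+δ)/Φ̄(x) ≥ exp(−ρ(x)δ − δ²/2). -/

import Mathlib

/-- Standard normal density. -/
noncomputable def stdPhi (x : ℝ) : ℝ := Real.exp (-x ^ 2 / 2) / Real.sqrt (2 * Real.pi)

/-- Standard normal upper-tail probability. -/
noncomputable def phiBar (x : ℝ) : ℝ := ∫ t in Set.Ioi x, stdPhi t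

/-- Standard normal hazard rate. -/
noncomputable def rho (x : ℝ) : ℝ := stdPhi x / phiBar x

/-- The difference r(x) = ρ(x) − x. -/
noncomputable def rFun (x : ℝ) : ℝ := rho x - x

/-- Ψ(x) = −log Φ̄(x). -/
noncomputable def Psi (x : ℝ) : ℝ := -Real.log (phiBar x)

open MeasureTheory Set Filter Topology

theorem stdPhi_eq (x : ℝ) :
    stdPhi x = (Real.sqrt (2 * Real.pi))⁻¹ * Real.exp (-(1 / 2) * x ^ 2) := by
  unfold stdPhi
  rw [div_eq_inv_mul]
  congr 2
  ring

theorem stdPhi_pos (x : ℝ) : 0 < stdPhi x := by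
  unfold stdPhi
  positivity

theorem integrable_stdPhi : Integrable stdPhi := by
  rw [show stdPhi = _ from funext stdPhi_eq]
  exact (integrable_exp_neg_mul_sq (by norm_num)).const_mul _

theorem integrable_mul_stdPhi : Integrable fun t => t * stdPhi t := by
  have h := (integrable_mul_exp_neg_mul_sq (b := 1 / 2) (by norm_num)).const_mul
    (Real.sqrt (2 * Real.pi))⁻¹
  refine h.congr (.of_forall fun t => ?_)
  simp only [stdPhi_eq]
  ring

theorem hasDerivAt_stdPhi (x : ℝ) : HasDerivAt stdPhi (-(x * stdPhi x)) x := by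
  have h : HasDerivAt (fun t : ℝ => -t ^ 2 / 2) (-x) x := by
    refine ((hasDerivAt_pow 2 x).neg.div_const 2).congr_deriv ?_
    norm_num
    ring
  refine (h.exp.div_const (Real.sqrt (2 * Real.pi))).congr_deriv ?_
  unfold stdPhi
  ring

theorem tendsto_stdPhi_atTop : Tendsto stdPhi atTop (𝓝 0) := by
  have h : Tendsto (fun t : ℝ => -t ^ 2 / 2) atTop atBot := by
    have h2 : Tendsto (fun t : ℝ => t ^ 2 / 2) atTop atTop :=
      (tendsto_pow_atTop two_ne_zero).atTop_div_const two_pos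
    refine (tendsto_neg_atTop_atBot.comp h2).congr fun t => ?_
    simp only [Function.comp_apply]
    ring
  have h3 := (Real.tendsto_exp_atBot.comp h).div_const (Real.sqrt (2 * Real.pi))
  rwa [zero_div] at h3

/-- The first partial moment of the standard normal density. -/
theorem integral_Ioi_mul_stdPhi (x : ℝ) : ∫ t in Ioi x, t * stdPhi t = stdPhi x := by
  have h := integral_Ioi_of_hasDerivAt_of_tendsto' (a := x)
    (fun t _ => hasDerivAt_stdPhi t) integrable_mul_stdPhi.neg.integrableOn tendsto_stdPhi_atTop
  rw [integral_neg] at h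
  linarith

theorem phiBar_pos (x : ℝ) : 0 < phiBar x := by
  unfold phiBar
  rw [setIntegral_pos_iff_support_of_nonneg_ae (.of_forall fun t => (stdPhi_pos t).le)
    integrable_stdPhi.integrableOn]
  have h : Function.support stdPhi = univ := by
    ext t
    simp [(stdPhi_pos t).ne']
  simp [h]

theorem stdPhi_add (t δ : ℝ) :
    stdPhi (t + δ) = stdPhi t * Real.exp (-t * δ - δ ^ 2 / 2) := by
  unfold stdPhi
  rw [div_mul_eq_mul_div, ← Real.exp_add]
  congr 2
  ring

theorem phiBar_add (x δ : ℝ) : phiBar (x + δ) = ∫ t in Ioi x, stdPhi (t + δ) := by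
  have h := (measurePreserving_add_right volume δ).setIntegral_preimage_emb
    (measurableEmbedding_addRight δ) stdPhi (Ioi (x + δ))
  rw [preimage_add_const_Ioi, add_sub_cancel_right] at h
  exact h.symm

theorem phiBar_add_le (x δ : ℝ) (hδ : 0 ≤ δ) :
    phiBar (x + δ) ≤ Real.exp (-x * δ - δ ^ 2 / 2) * phiBar x := by
  rw [phiBar_add, phiBar, ← integral_const_mul]
  refine setIntegral_mono_on (integrable_stdPhi.comp_add_right δ).integrableOn
    (integrable_stdPhi.const_mul _).integrableOn measurableSet_Ioi fun t ht => ?_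
  rw [stdPhi_add, mul_comm]
  refine mul_le_mul_of_nonneg_right (Real.exp_le_exp.2 ?_) (stdPhi_pos t).le
  nlinarith [mem_Ioi.1 ht]

theorem le_phiBar_add (x δ : ℝ) :
    Real.exp (-rho x * δ - δ ^ 2 / 2) * phiBar x ≤ phiBar (x + δ) := by
  have hρ : rho x * phiBar x = stdPhi x := div_mul_cancel₀ _ (phiBar_pos x).ne'
  set c := Real.exp (-rho x * δ - δ ^ 2 / 2) with hc
  have hi₁ : Integrable fun t => c * (1 + rho x * δ) * stdPhi t := integrable_stdPhi.const_mul _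
  have hi₂ : Integrable fun t => c * δ * (t * stdPhi t) := integrable_mul_stdPhi.const_mul _
  have hint : ∫ t in Ioi x, (c * (1 + rho x * δ) * stdPhi t - c * δ * (t * stdPhi t)) =
      c * phiBar x := by
    rw [integral_sub hi₁.integrableOn hi₂.integrableOn, integral_const_mul, integral_const_mul,
      integral_Ioi_mul_stdPhi, ← hρ, ← phiBar]
    ring
  rw [← hint, phiBar_add]
  refine setIntegral_mono_on (hi₁.sub hi₂).integrableOn
    (integrable_stdPhi.comp_add_right δ).integrableOn measurableSet_Ioi fun t _ => ?_
  have he : Real.exp (-t * δ - δ ^ 2 / 2) = c * Real.exp (rho x * δ - t * δ) := by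
    rw [hc, ← Real.exp_add]
    congr 1
    ring
  have htan := Real.add_one_le_exp (rho x * δ - t * δ)
  have hpos : 0 ≤ stdPhi t * c := mul_nonneg (stdPhi_pos t).le (Real.exp_pos _).le
  rw [stdPhi_add, he]
  linarith [mul_le_mul_of_nonneg_left htan hpos]

theorem Psi_increment_quadratic_bounds (x δ : ℝ) (hδ : 0 ≤ δ) :
    x * δ + δ ^ 2 / 2 ≤ Psi (x + δ) - Psi x ∧
      Psi (x + δ) - Psi x ≤ rho x * δ + δ ^ 2 / 2 := by
  have hx := phiBar_pos x
  have hu := Real.log_le_log (phiBar_pos _) (phiBar_add_le x δ hδ)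
  have hl := Real.log_le_log (by positivity) (le_phiBar_add x δ)
  rw [Real.log_mul (Real.exp_pos _).ne' hx.ne', Real.log_exp] at hu hl
  unfold Psi
  constructor <;> linarith
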